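/- Characterization of computability relative to the halting problem: A partial function F :⊆ ℕ^ℕ → ℕ^ℕ is computable relative to the halting problem 0' if and only if there exists a computable partial function G :⊆ ℕ^ℕ → ℕ^ℕ such that F = G ∘ H, where H := J ∘ lim⁻¹ is the multi-valued map assigning to p the set of Turing jumps of all sequences converging to p. -/

import Mathlib

open scoped Classical

namespace LimitComp

/-- Baire space `ℕ^ℕ`. -/
abbrev Baire : Type := ℕ → ℕ

/-- The finite prefix of length `k` of a point of Baire space. -/
def pre (p : Baire) (k : ℕ) : List ℕ := List.ofFn fun i : Fin k => p i

/-- Interleaving pairing `⟨q,p⟩(2n) = q(n)`, `⟨q,p⟩(2n+1) = p(n)`. -/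
def pairB (q p : Baire) : Baire := fun n => if n % 2 = 0 then q (n / 2) else p (n / 2)

/-- The `i`-th component of a tupling `⟨p₀,p₁,p₂,...⟩`. -/
def seqOf (p : Baire) (i : ℕ) : Baire := fun n => p (Nat.pair i n)

/-- Tupling `⟨p₀,p₁,p₂,...⟩` of a sequence of points of Baire space. -/
def tup (ps : ℕ → Baire) : Baire := fun m => ps m.unpair.1 m.unpair.2

/-- The limit map `lim :⊆ ℕ^ℕ → ℕ^ℕ`; it maps `⟨p₀,p₁,p₂,...⟩` to its pointwise
limit, which is defined whenever every coordinate is eventually constant. -/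
noncomputable def limB : Baire →. Baire := fun p =>
  ⟨∀ n, ∃ i₀, ∀ i, i₀ ≤ i → seqOf p i n = seqOf p i₀ n,
   fun h n => seqOf p (Classical.choose (h n)) n⟩

/-- Monotonicity of a finite approximation function under prefix extension
(this corresponds to a one-way output tape). -/
def PrefixMono (η : List ℕ → ℕ → Option ℕ) : Prop :=
  ∀ u v n y, u <+: v → η u n = some y → η v n = some y

/-- `η` approximates the partial function `F`: for every input in the domain of `F`
every output position is eventually filled with the correct output value. -/
def OneWayApprox (η : List ℕ → ℕ → Option ℕ) (F : Baire →. Baire) : Prop :=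
  ∀ p q, q ∈ F p → ∀ n, ∃ k, η (pre p k) n = some (q n)

/-- Computability for partial functions on Baire space: `F` is computed by a
Turing machine with one-way output tape, formalized via a computable monotone
finite approximation function. -/
def ComputableFn (F : Baire →. Baire) : Prop :=
  ∃ η : List ℕ → ℕ → Option ℕ, Computable₂ η ∧ PrefixMono η ∧ OneWayApprox η F

/-- `η` is a limit approximation of `F`: on every input in the domain of `F`,
every output cell eventually stabilizes to the correct output value. -/
def LimitApprox (η : List ℕ → ℕ → ℕ) (F : Baire →. Baire) : Prop :=
  ∀ p q, q ∈ F p → ∀ n, ∃ k₀, ∀ k, k₀ ≤ k → η (pre p k) n = q n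

/-- Limit computability for partial functions on Baire space: `F` is computed by
a Turing machine with a two-way output tape such that on inputs in the domain
every output cell eventually stabilizes. -/
def LimitComputableFn (F : Baire →. Baire) : Prop :=
  ∃ η : List ℕ → ℕ → ℕ, Computable₂ η ∧ LimitApprox η F

/-- The `i`-th Turing machine halts on input `p ∈ ℕ^ℕ` (i.e. it halts after
having read some finite prefix of `p`). -/
def haltsOn (i : ℕ) (p : Baire) : Prop :=
  ∃ k, ((Denumerable.ofNat Nat.Partrec.Code i).eval (Encodable.encode (pre p k))).Dom

/-- The Turing jump operator `J : ℕ^ℕ → ℕ^ℕ`. -/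
noncomputable def jump (p : Baire) : Baire := fun i => if haltsOn i p then 1 else 0

/-- The halting problem `0'`. -/
noncomputable def zero' : Baire := jump fun _ => 0

/-- `F` is computable relative to the oracle `q`. -/
def ComputableRel (q : Baire) (F : Baire →. Baire) : Prop :=
  ∃ G : Baire →. Baire, ComputableFn G ∧ ∀ p r, r ∈ F p → r ∈ G (pairB q p)

/-- `F` is limit computable relative to the oracle `q`. -/
def LimitComputableRel (q : Baire) (F : Baire →. Baire) : Prop :=
  ∃ G : Baire →. Baire, LimitComputableFn G ∧ ∀ p r, r ∈ F p → r ∈ G (pairB q p)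

/-- Turing reducibility for points of Baire space. -/
def TuringLe (p q : Baire) : Prop :=
  ∃ F : Baire →. Baire, ComputableFn F ∧ p ∈ F q

end LimitComp

namespace LimitComp

open Encodable Denumerable Filter
open Nat.Partrec (Code)

theorem length_pre (p : Baire) (k : ℕ) : (pre p k).length = k := by simp [pre]

theorem getElem?_pre {p : Baire} {k t : ℕ} (h : t < k) : (pre p k)[t]? = some (p t) := by
  simp [pre, h]

theorem eq_pre {l : List ℕ} {p : Baire} (h : ∀ t < l.length, l[t]? = some (p t)) :
    l = pre p l.length := by
  apply List.ext_getElem?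
  intro t
  by_cases ht : t < l.length
  · rw [h t ht, getElem?_pre ht]
  · rw [List.getElem?_eq_none (by omega), List.getElem?_eq_none (by rw [length_pre]; omega)]

theorem take_pre (p : Baire) (j k : ℕ) : (pre p k).take j = pre p (min j k) := by
  have h := eq_pre (l := (pre p k).take j) (p := p) fun t ht => by
    rw [List.length_take, length_pre] at ht
    rw [List.getElem?_take_of_lt (by omega), getElem?_pre (by omega)]
  rwa [List.length_take, length_pre] at h

theorem pre_mono (p : Baire) {j k : ℕ} (h : j ≤ k) : pre p j <+: pre p k := by
  have : (pre p k).take j <+: pre p k := ⟨_, List.take_append_drop j (pre p k)⟩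
  rwa [take_pre, min_eq_left h] at this

theorem PrefixMono.unique {η : List ℕ → ℕ → Option ℕ} (h : PrefixMono η) {p : Baire}
    {j k n y z : ℕ} (hy : η (pre p j) n = some y) (hz : η (pre p k) n = some z) : y = z := by
  have h₁ := h _ _ _ _ (pre_mono p (le_max_left j k)) hy
  have h₂ := h _ _ _ _ (pre_mono p (le_max_right j k)) hz
  exact Option.some.inj (h₁.symm.trans h₂)

/-- The largest partial function approximated by `η`. -/
noncomputable def ofApprox (η : List ℕ → ℕ → Option ℕ) : Baire →. Baire := fun p =>
  ⟨∀ n, ∃ y k, η (pre p k) n = some y, fun h n => Classical.choose (h n)⟩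

theorem mem_ofApprox {η : List ℕ → ℕ → Option ℕ} (hη : PrefixMono η) {p q : Baire} :
    q ∈ ofApprox η p ↔ ∀ n, ∃ k, η (pre p k) n = some (q n) := by
  constructor
  · rintro ⟨h, rfl⟩ n
    exact Classical.choose_spec (h n)
  · intro h
    refine ⟨fun n => ⟨q n, h n⟩, funext fun n => ?_⟩
    obtain ⟨k, hk⟩ := h n
    obtain ⟨j, hj⟩ := Classical.choose_spec (p := fun y => ∃ k, η (pre p k) n = some y) ⟨q n, k, hk⟩
    exact hη.unique hj hk

theorem computableFn_ofApprox {η : List ℕ → ℕ → Option ℕ} (hc : Computable₂ η)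
    (hη : PrefixMono η) : ComputableFn (ofApprox η) :=
  ⟨η, hc, hη, fun _ _ h => (mem_ofApprox hη).1 h⟩

theorem limB_eq_some_iff {r p : Baire} :
    limB r = Part.some p ↔ ∀ n, ∃ i₀, ∀ i, i₀ ≤ i → r (Nat.pair i n) = p n := by
  rw [Part.eq_some_iff]
  constructor
  · rintro ⟨h, rfl⟩ n
    exact ⟨_, Classical.choose_spec (h n)⟩
  · intro h
    have hd : (limB r).Dom := fun n => by
      obtain ⟨i₀, hi⟩ := h n
      exact ⟨i₀, fun i hi' => (hi i hi').trans (hi i₀ le_rfl).symm⟩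
    refine ⟨hd, funext fun n => ?_⟩
    obtain ⟨i₀, hi⟩ := h n
    have hs := Classical.choose_spec (hd n)
    exact (hs (max i₀ (Classical.choose (hd n))) (le_max_right _ _)).symm.trans
      (hi _ (le_max_left _ _))

/-- The s-m-n theorem for r.e. relations given by a primitive recursive matrix. -/
theorem exists_index {α : Type*} [Primcodable α] {R : α × List ℕ → ℕ → Prop}
    (hR : PrimrecRel R) :
    ∃ f : α → ℕ, Primrec f ∧
      ∀ a u, ((ofNat Code (f a)).eval (encode u)).Dom ↔ ∃ m, R (a, u) m := by
  have hp : Partrec₂ fun (x : α × List ℕ) (m : ℕ) => (Part.some (decide (R x m)) : Part Bool) :=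
    (PrimrecRel.decide hR).to_comp.partrec
  obtain ⟨c, hc⟩ := Code.exists_code.1 (Partrec.rfind hp)
  refine ⟨fun a => encode (c.curry (encode a)),
    Primrec.encode.comp (Code.primrec₂_curry.comp (.const c) .encode), fun a u => ?_⟩
  rw [ofNat_encode, Code.eval_curry, hc]
  have : (decode (Nat.pair (encode a) (encode u)) : Option (α × List ℕ)) = some (a, u) :=
    encodek (a, u)
  simp only [this, Part.coe_some, Part.bind_some, Part.map_Dom]
  refine Nat.rfind_dom'.trans ?_
  simp

theorem exists_index_const {α : Type*} [Primcodable α] {R : α → ℕ → Prop} (hR : PrimrecRel R) :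
    ∃ f : α → ℕ, Primrec f ∧ ∀ a p, haltsOn (f a) p ↔ ∃ m, R a m := by
  obtain ⟨f, hf, h⟩ := exists_index (R := fun (x : α × List ℕ) m => R x.1 m)
    (hR.comp (Primrec.fst.comp .fst) .snd)
  exact ⟨f, hf, fun a p => by simp [haltsOn, h]⟩

theorem jump_eq_one {r : Baire} {i : ℕ} : jump r i = 1 ↔ haltsOn i r := by
  simp [jump]

theorem jump_eq_zero {r : Baire} {i : ℕ} : jump r i = 0 ↔ ¬haltsOn i r := by
  simp [jump]

/-- The first value of `f` among the arguments below `N` at which `f` is defined. -/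
def firstBelow (f : ℕ → Option ℕ) : ℕ → Option ℕ :=
  Nat.rec none fun m o => o <|> f m

theorem firstBelow_succ (f : ℕ → Option ℕ) (N : ℕ) :
    firstBelow f (N + 1) = (firstBelow f N <|> f N) := rfl

theorem exists_of_firstBelow_eq_some {f : ℕ → Option ℕ} {N y : ℕ}
    (h : firstBelow f N = some y) : ∃ m < N, f m = some y := by
  induction N with
  | zero => cases h
  | succ N ih =>
    rw [firstBelow_succ] at h
    cases hs : firstBelow f N with
    | none =>
      rw [hs] at h
      exact ⟨N, by omega, by simpa using h⟩
    | some z =>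
      rw [hs] at h
      obtain ⟨m, hm, h'⟩ := ih (hs.trans (by simpa using h))
      exact ⟨m, by omega, h'⟩

theorem firstBelow_isSome {f : ℕ → Option ℕ} {m N : ℕ} (hm : m < N) (h : (f m).isSome) :
    (firstBelow f N).isSome := by
  induction N with
  | zero => omega
  | succ N ih =>
    rw [firstBelow_succ]
    rcases Nat.lt_succ_iff_lt_or_eq.1 hm with h' | rfl
    · simp [ih h']
    · simp [h]

theorem firstBelow_mono {f : ℕ → Option ℕ} {M N y : ℕ} (h : M ≤ N)
    (hy : firstBelow f M = some y) : firstBelow f N = some y := by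
  induction h with
  | refl => exact hy
  | step _ ih => rw [Nat.succ_eq_add_one, firstBelow_succ, ih]; rfl

theorem firstBelow_congr {f g : ℕ → Option ℕ} {N : ℕ} (h : ∀ m < N, f m = g m) :
    firstBelow f N = firstBelow g N := by
  induction N with
  | zero => rfl
  | succ N ih =>
    rw [firstBelow_succ, firstBelow_succ, h N (by omega), ih fun m hm => h m (by omega)]

theorem computable_firstBelow {α : Type*} [Primcodable α] {f : α → ℕ → Option ℕ} {g : α → ℕ}
    (hf : Computable₂ f) (hg : Computable g) : Computable fun a => firstBelow (f a) (g a) := by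
  refine Computable.nat_rec (h := fun a (y : ℕ × Option ℕ) => y.2 <|> f a y.1)
    hg (.const none) ?_
  exact Computable₂.comp (f := fun a b : Option ℕ => a <|> b) Primrec.option_orElse.to_comp
    (Computable.snd.comp .snd) (hf.comp .fst (Computable.fst.comp .snd))

/-- The output `η w n` if `m` codes a certificate `a` together with a list `w` and a length `k`
such that the prefix of `u` of length `k` certifies `(a, w)`. -/
noncomputable def certified {α : Type*} [Primcodable α] (η : List ℕ → ℕ → Option ℕ)
    (C : List ℕ → α × List ℕ → Prop) (u : List ℕ) (n m : ℕ) : Option ℕ :=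
  (decode (α := α × List ℕ) m.unpair.1).bind fun d =>
    bif decide (C (u.take m.unpair.2) d) then η d.2 n else none

section Certificates

variable {α : Type*} [Primcodable α] {η : List ℕ → ℕ → Option ℕ}
  {C : List ℕ → α × List ℕ → Prop}

theorem computable_certified (hc : Computable₂ η) (hC : PrimrecRel C) :
    Computable₂ fun (x : List ℕ × ℕ) (m : ℕ) => certified η C x.1 x.2 m := by
  have hd : Primrec fun x : ((List ℕ × ℕ) × ℕ) × (α × List ℕ) =>
      decide (C (x.1.1.1.take x.1.2.unpair.2) x.2) := by
    refine PrimrecPred.decide (hC.comp (Primrec.list_take.comp ?_ ?_) Primrec.snd)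
    · exact Primrec.snd.comp (Primrec.unpair.comp (Primrec.snd.comp .fst))
    · exact Primrec.fst.comp (Primrec.fst.comp .fst)
  have he : Computable fun x : ((List ℕ × ℕ) × ℕ) × (α × List ℕ) => η x.2.2 x.1.1.2 :=
    hc.comp (Computable.snd.comp .snd) (Computable.snd.comp (Computable.fst.comp .fst))
  exact Computable.option_bind (β := α × List ℕ)
    (Primrec.decode.comp (Primrec.fst.comp (Primrec.unpair.comp .snd))).to_comp
    (Computable.cond hd.to_comp he (.const none))

theorem certified_congr {u v : List ℕ} {n m : ℕ} (huv : u <+: v) (h : m < u.length) :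
    certified η C u n m = certified η C v n m := by
  obtain ⟨t, rfl⟩ := huv
  have : m.unpair.2 ≤ u.length := (Nat.unpair_right_le m).trans h.le
  simp only [certified, List.take_append_of_le_length this]

theorem certified_eq_some {p : Baire} {k n m y : ℕ} (h : certified η C (pre p k) n m = some y) :
    ∃ j a w, C (pre p j) (a, w) ∧ η w n = some y := by
  simp only [certified, Option.bind_eq_some_iff] at h
  obtain ⟨⟨a, w⟩, -, h⟩ := h
  by_cases hCw : C ((pre p k).take m.unpair.2) (a, w)
  · simp only [hCw, decide_true, cond_true] at h
    rw [take_pre] at hCw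
    exact ⟨_, a, w, hCw, h⟩
  · simp [hCw] at h

theorem exists_certified {p : Baire} {k : ℕ} {a : α} {w : List ℕ} (hk : C (pre p k) (a, w))
    (n : ℕ) : ∃ m, certified η C (pre p (m + 1)) n m = η w n := by
  refine ⟨Nat.pair (encode (a, w)) k, ?_⟩
  have hkm : k ≤ Nat.pair (encode (a, w)) k := Nat.right_le_pair _ _
  simp only [certified, Nat.unpair_pair, encodek, Option.bind_some]
  rw [take_pre, min_eq_left (by omega)]
  simp [hk]

/-- Searching for lists `w` certified by prefixes of `p` and running `η` on them yields again a
computable one-way approximation. It computes `q` from `p` if all certified lists are prefixes of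
points from which `η` computes `q`, and all prefixes of some such point are certified. -/
theorem exists_approx_of_certificate (hc : Computable₂ η) (hm : PrefixMono η)
    (hC : PrimrecRel C) :
    ∃ η' : List ℕ → ℕ → Option ℕ, Computable₂ η' ∧ PrefixMono η' ∧
      ∀ p q : Baire,
        (∀ k a w, C (pre p k) (a, w) →
          ∃ x, w = pre x w.length ∧ ∀ n, ∃ j, η (pre x j) n = some (q n)) →
        (∃ x, (∀ n, ∃ j, η (pre x j) n = some (q n)) ∧
          ∀ j, ∃ a k, C (pre p k) (a, pre x j)) →
        ∀ n, ∃ k, η' (pre p k) n = some (q n) := by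
  refine ⟨fun u n => firstBelow (certified η C u n) u.length,
    computable_firstBelow (computable_certified hc hC) (Computable.list_length.comp .fst), ?_, ?_⟩
  · intro u v n y huv h
    exact firstBelow_mono huv.length_le
      ((firstBelow_congr fun m hm => certified_congr huv hm).symm.trans h)
  · intro p q hs ⟨x, hq, hx⟩ n
    obtain ⟨j, hj⟩ := hq n
    obtain ⟨a, k, hk⟩ := hx j
    obtain ⟨m, hφ⟩ := exists_certified (η := η) hk n
    refine ⟨m + 1, ?_⟩
    have h := firstBelow_isSome (f := certified η C (pre p (m + 1)) n) (N := m + 1)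
      (Nat.lt_succ_self m) (by rw [hφ, hj]; rfl)
    obtain ⟨y, hy⟩ := Option.isSome_iff_exists.1 h
    obtain ⟨m', -, hm'⟩ := exists_of_firstBelow_eq_some hy
    obtain ⟨i, b, w, hw, hwy⟩ := certified_eq_some hm'
    obtain ⟨z, hz, hqz⟩ := hs i b w hw
    obtain ⟨l, hl⟩ := hqz n
    rw [hz] at hwy
    simp only [length_pre, hy, hm.unique hwy hl]

end Certificates

theorem forall_lt_primrec {α : Type*} [Primcodable α] {R : ℕ → α → Prop} {f : α → ℕ}
    (hR : PrimrecRel R) (hf : Primrec f) : PrimrecPred fun a => ∀ x < f a, R x a :=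
  (hR.forall_mem_list.comp (Primrec.list_range.comp hf) Primrec.id).of_eq (by simp)

theorem pairB_even (q p : Baire) (n : ℕ) : pairB q p (2 * n) = q n := by
  simp [pairB]

theorem pairB_odd (q p : Baire) (n : ℕ) : pairB q p (2 * n + 1) = p n := by
  simp [pairB, Nat.add_mod, show (2 * n + 1) / 2 = n by omega]

theorem lt_of_getElem?_pre {p : Baire} {k t y : ℕ} (h : (pre p k)[t]? = some y) : t < k := by
  by_contra hk
  rw [List.getElem?_eq_none (by rw [length_pre]; omega)] at h
  cases h

theorem eq_of_getElem?_pre {p : Baire} {k t y : ℕ} (h : (pre p k)[t]? = some y) : p t = y := by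
  rw [getElem?_pre (lt_of_getElem?_pre h)] at h
  exact Option.some.inj h

theorem eventually_getElem?_pre (p : Baire) (t : ℕ) :
    ∀ᶠ k in atTop, (pre p k)[t]? = some (p t) :=
  (eventually_gt_atTop t).mono fun _ h => getElem?_pre h

theorem eventually_forall_lt {P : ℕ → ℕ → Prop} {N : ℕ} (h : ∀ t < N, ∀ᶠ k in atTop, P t k) :
    ∀ᶠ k in atTop, ∀ t < N, P t k :=
  (Filter.eventually_all_finite (Set.finite_lt_nat N)).2 h

theorem haltsOn_iff_evaln {i : ℕ} {p : Baire} : haltsOn i p ↔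
    ∃ k s, (Code.evaln s (ofNat Code i) (encode (pre p k))).isSome := by
  simp only [haltsOn, Part.dom_iff_mem, Code.evaln_complete, Option.isSome_iff_exists,
    Option.mem_def]
  exact exists_congr fun k => ⟨fun ⟨y, s, h⟩ => ⟨s, y, h⟩, fun ⟨s, y, h⟩ => ⟨y, s, h⟩⟩

theorem primrecRel_evaln_isSome {α : Type*} [Primcodable α] {s i : α → ℕ} {u : α → List ℕ}
    (hs : Primrec s) (hi : Primrec i) (hu : Primrec u) :
    PrimrecPred fun a => (Code.evaln (s a) (ofNat Code (i a)) (encode (u a))).isSome = true :=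
  Primrec.eq.comp (Primrec.option_isSome.comp (Code.primrec_evaln.comp
    (((hs.pair ((Primrec.ofNat Code).comp hi)).pair (Primrec.encode.comp hu))))) (.const true)

theorem pre_zero_fun (k : ℕ) : pre (fun _ => 0) k = (List.range k).map fun _ => 0 := by
  apply List.ext_getElem <;> simp [pre]

/-- The halting problem is uniformly reducible to the jump of any point. -/
theorem exists_index_zero' : ∃ g : ℕ → ℕ, Primrec g ∧ ∀ r i, jump r (g i) = zero' i := by
  obtain ⟨g, hg, h⟩ := exists_index_const (R := fun i m : ℕ =>
    (Code.evaln m.unpair.1 (ofNat Code i)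
      (encode ((List.range m.unpair.2).map fun _ => 0))).isSome = true)
    (primrecRel_evaln_isSome (Primrec.fst.comp (Primrec.unpair.comp .snd)) .fst
      (Primrec.list_map (Primrec.list_range.comp (Primrec.snd.comp (Primrec.unpair.comp .snd)))
        (Primrec.const 0).to₂))
  refine ⟨g, hg, fun r i => ?_⟩
  have : haltsOn (g i) r ↔ haltsOn i fun _ => 0 := by
    rw [h, haltsOn_iff_evaln]
    simp only [pre_zero_fun]
    exact ⟨fun ⟨m, hm⟩ => ⟨_, _, hm⟩, fun ⟨k, s, hm⟩ => ⟨Nat.pair s k, by simpa using hm⟩⟩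
  simp [zero', jump, this]

/-- The limit of a sequence is uniformly co-r.e. in the sequence. -/
theorem exists_index_lim : ∃ f : ℕ × ℕ × ℕ → ℕ, Primrec f ∧
    ∀ r n b y, jump r (f (n, b, y)) = 0 ↔ ∀ i, b ≤ i → r (Nat.pair i n) = y := by
  have hR : PrimrecRel fun (x : (ℕ × ℕ × ℕ) × List ℕ) (i : ℕ) => x.1.2.1 ≤ i ∧
      Nat.pair i x.1.1 < x.2.length ∧ ¬ x.2[Nat.pair i x.1.1]? = some x.1.2.2 := by
    have hp : Primrec fun z : ((ℕ × ℕ × ℕ) × List ℕ) × ℕ => Nat.pair z.2 z.1.1.1 :=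
      Primrec₂.natPair.comp .snd (Primrec.fst.comp (Primrec.fst.comp .fst))
    have hb : Primrec fun z : ((ℕ × ℕ × ℕ) × List ℕ) × ℕ => z.1.1.2 :=
      Primrec.snd.comp (Primrec.fst.comp .fst)
    have hu : Primrec fun z : ((ℕ × ℕ × ℕ) × List ℕ) × ℕ => z.1.2 := Primrec.snd.comp .fst
    exact (Primrec.nat_le.comp (Primrec.fst.comp hb) .snd).and
      ((Primrec.nat_lt.comp hp (Primrec.list_length.comp hu)).and
        (Primrec.eq.comp (Primrec.list_getElem?.comp hu hp)
          (Primrec.option_some.comp (Primrec.snd.comp hb))).not)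
  obtain ⟨f, hf, h⟩ := exists_index hR
  refine ⟨f, hf, fun r n b y => ?_⟩
  rw [jump_eq_zero, haltsOn, not_exists]
  simp only [h, length_pre, not_exists, not_and, not_not]
  constructor
  · intro H i hi
    exact eq_of_getElem?_pre (H (Nat.pair i n + 1) i hi (Nat.lt_succ_self _))
  · intro H k i hi hk
    rw [getElem?_pre hk, H i hi]

theorem exists_of_computableRel {F : Baire →. Baire} (h : ComputableRel zero' F) :
    ∃ G : Baire →. Baire, ComputableFn G ∧
      ∀ p, (F p).Dom → ∀ r : Baire, limB r = Part.some p → G (jump r) = F p := by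
  obtain ⟨G, ⟨η, hc, hm, hG⟩, hF⟩ := h
  obtain ⟨g, hg, hg'⟩ := exists_index_zero'
  obtain ⟨f, hf, hf'⟩ := exists_index_lim
  let C : List ℕ → ℕ × List ℕ → Prop := fun u d => ∀ t < d.2.length,
    (t % 2 = 0 ∧ u[g (t / 2)]? = d.2[t]?) ∨
      (t % 2 = 1 ∧ u[f (t / 2, d.1, d.2.getD t 0)]? = some 0)
  have hC : PrimrecRel C := by
    have hu : Primrec fun z : ℕ × List ℕ × ℕ × List ℕ => z.2.1 := Primrec.fst.comp .snd
    have hb : Primrec fun z : ℕ × List ℕ × ℕ × List ℕ => z.2.2.1 :=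
      Primrec.fst.comp (Primrec.snd.comp .snd)
    have hw : Primrec fun z : ℕ × List ℕ × ℕ × List ℕ => z.2.2.2 :=
      Primrec.snd.comp (Primrec.snd.comp .snd)
    have hmod : Primrec fun z : ℕ × List ℕ × ℕ × List ℕ => z.1 % 2 :=
      Primrec.nat_mod.comp .fst (.const 2)
    have hdiv : Primrec fun z : ℕ × List ℕ × ℕ × List ℕ => z.1 / 2 :=
      Primrec.nat_div.comp .fst (.const 2)
    have hR : PrimrecRel fun (t : ℕ) (x : List ℕ × ℕ × List ℕ) =>
        (t % 2 = 0 ∧ x.1[g (t / 2)]? = x.2.2[t]?) ∨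
          (t % 2 = 1 ∧ x.1[f (t / 2, x.2.1, x.2.2.getD t 0)]? = some 0) :=
      ((Primrec.eq.comp hmod (.const 0)).and
        (Primrec.eq.comp (Primrec.list_getElem?.comp hu (hg.comp hdiv))
          (Primrec.list_getElem?.comp hw .fst))).or
      ((Primrec.eq.comp hmod (.const 1)).and
        (Primrec.eq.comp (Primrec.list_getElem?.comp hu
          (hf.comp (hdiv.pair (hb.pair ((Primrec.list_getD 0).comp hw .fst))))) (.const (some 0))))
    exact forall_lt_primrec hR (Primrec.list_length.comp (Primrec.snd.comp .snd))
  obtain ⟨η', hc', hm', hη⟩ := exists_approx_of_certificate hc hm hC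
  refine ⟨ofApprox η', computableFn_ofApprox hc' hm', fun p hp r hr => ?_⟩
  obtain ⟨q, hq⟩ := Part.dom_iff_mem.1 hp
  rw [Part.eq_some_iff.2 hq, Part.eq_some_iff, mem_ofApprox hm']
  have hx := hG _ _ (hF p q hq)
  rw [limB_eq_some_iff] at hr
  refine hη (jump r) q ?_ ⟨pairB zero' p, hx, fun j => ?_⟩
  · intro k b w hw
    refine ⟨pairB zero' p, eq_pre fun t ht => ?_, hx⟩
    rcases hw t ht with ⟨ht2, h⟩ | ⟨ht2, h⟩
    · obtain ⟨s, rfl⟩ : ∃ s, t = 2 * s := ⟨t / 2, by omega⟩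
      rw [show 2 * s / 2 = s by omega] at h
      simp only [List.getElem?_eq_getElem ht] at h ⊢
      rw [← eq_of_getElem?_pre h, hg', pairB_even]
    · obtain ⟨s, rfl⟩ : ∃ s, t = 2 * s + 1 := ⟨t / 2, by omega⟩
      rw [show (2 * s + 1) / 2 = s by omega] at h
      have h := (hf' _ _ _ _).1 (eq_of_getElem?_pre h)
      obtain ⟨i₀, hi⟩ := hr s
      have h₁ := h (max b i₀) (le_max_left _ _)
      rw [hi _ (le_max_right _ _)] at h₁
      rw [pairB_odd, h₁]
      simp [List.getElem?_eq_getElem ht]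
  · obtain ⟨b, hb⟩ := (eventually_forall_lt (N := j) (P := fun t b =>
        ∀ i, b ≤ i → r (Nat.pair i (t / 2)) = p (t / 2)) fun t _ => by
      obtain ⟨i₀, hi⟩ := hr (t / 2)
      exact (eventually_ge_atTop i₀).mono fun b hb i hi' => hi i (hb.trans hi')).exists
    refine ⟨b, (eventually_forall_lt fun t ht => ?_).exists⟩
    rw [length_pre] at ht
    rcases Nat.mod_two_eq_zero_or_one t with h | h
    · filter_upwards [eventually_getElem?_pre (jump r) (g (t / 2))] with k hk
      left
      simp only [getElem?_pre ht]
      refine ⟨h, hk.trans ?_⟩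
      rw [hg', pairB, if_pos h]
    · filter_upwards [eventually_getElem?_pre (jump r)
        (f (t / 2, b, (pre (pairB zero' p) j).getD t 0))] with k hk
      right
      refine ⟨h, hk.trans ?_⟩
      rw [Option.some_inj, hf']
      rw [List.getD_eq_getElem?_getD, getElem?_pre ht, pairB, if_neg (by omega)]
      exact hb t ht

/-- The `i`-th Turing machine halts after having read some prefix of the finite list `l`. -/
def HaltsWithin (i : ℕ) (l : List ℕ) : Prop :=
  ∃ k, ((ofNat Code i).eval (encode (l.take k))).Dom

theorem HaltsWithin.mono {i : ℕ} {l l' : List ℕ} (h : HaltsWithin i l) (hl : l <+: l') :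
    HaltsWithin i l' := by
  obtain ⟨k, hk⟩ := h
  refine ⟨min k l.length, ?_⟩
  rwa [← List.take_take, ← List.prefix_iff_eq_take.1 hl]

theorem haltsOn_iff_haltsWithin {i : ℕ} {r : Baire} :
    haltsOn i r ↔ ∃ k, HaltsWithin i (pre r k) := by
  constructor
  · rintro ⟨k, hk⟩
    exact ⟨k, k, by rwa [take_pre, min_self]⟩
  · rintro ⟨k, j, hk⟩
    rw [take_pre] at hk
    exact ⟨_, hk⟩

theorem haltsWithin_iff_evaln {i : ℕ} {l : List ℕ} : HaltsWithin i l ↔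
    ∃ k s, (Code.evaln s (ofNat Code i) (encode (l.take k))).isSome := by
  simp only [HaltsWithin, Part.dom_iff_mem, Code.evaln_complete, Option.isSome_iff_exists,
    Option.mem_def]
  exact exists_congr fun k => ⟨fun ⟨y, s, h⟩ => ⟨s, y, h⟩, fun ⟨s, y, h⟩ => ⟨y, s, h⟩⟩

/-- `τ` extends `σ`, and all new entries in the first `m` columns agree with the entries of `p`. -/
def Extends (σ : List ℕ) (m : ℕ) (p : Baire) (τ : List ℕ) : Prop :=
  σ <+: τ ∧ ∀ t < τ.length, σ.length ≤ t → t.unpair.2 < m → τ[t]? = some (p t.unpair.2)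

theorem Extends.refl (σ : List ℕ) (m : ℕ) (p : Baire) : Extends σ m p σ :=
  ⟨List.prefix_rfl, fun _ h h' => absurd h h'.not_gt⟩

theorem Extends.trans {σ τ ρ : List ℕ} {m m' : ℕ} {p : Baire} (h : Extends σ m p τ)
    (h' : Extends τ m' p ρ) (hm : m ≤ m') : Extends σ m p ρ := by
  refine ⟨h.1.trans h'.1, fun t ht hσ htm => ?_⟩
  by_cases hτ : t < τ.length
  · have := h.2 t hτ hσ htm
    obtain ⟨x, rfl⟩ := h'.1
    rw [List.getElem?_append_left hτ, this]
  · exact h'.2 t ht (not_lt.1 hτ) (htm.trans_le hm)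

theorem extends_congr {σ τ : List ℕ} {m : ℕ} {p p' : Baire} (h : ∀ j < m, p j = p' j) :
    Extends σ m p τ ↔ Extends σ m p' τ := by
  refine and_congr_right fun _ => forall₄_congr fun t _ _ ht => ?_
  rw [h _ ht]

theorem extends_pre {σ : List ℕ} {m : ℕ} {p r : Baire} (hσ : σ = pre r σ.length)
    (hr : ∀ t, σ.length ≤ t → t.unpair.2 < m → r t = p t.unpair.2) {k : ℕ} (hk : σ.length ≤ k) :
    Extends σ m p (pre r k) := by
  refine ⟨hσ.symm ▸ pre_mono r hk, fun t ht hσt htm => ?_⟩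
  rw [length_pre] at ht
  rw [getElem?_pre ht, hr t hσt htm]

theorem exists_index_haltsWithin : ∃ f : ℕ × List ℕ → ℕ, Primrec f ∧
    ∀ i σ p, haltsOn (f (i, σ)) p ↔ HaltsWithin i σ := by
  obtain ⟨f, hf, h⟩ := exists_index_const (R := fun (x : ℕ × List ℕ) (m : ℕ) =>
    (Code.evaln m.unpair.1 (ofNat Code x.1) (encode (x.2.take m.unpair.2))).isSome = true)
    (primrecRel_evaln_isSome (Primrec.fst.comp (Primrec.unpair.comp .snd))
      (Primrec.fst.comp .fst)
      (Primrec.list_take.comp (Primrec.snd.comp (Primrec.unpair.comp .snd))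
        (Primrec.snd.comp .fst)))
  refine ⟨f, hf, fun i σ p => ?_⟩
  rw [h, haltsWithin_iff_evaln]
  exact ⟨fun ⟨m, hm⟩ => ⟨_, _, hm⟩, fun ⟨k, s, hm⟩ => ⟨Nat.pair s k, by simpa using hm⟩⟩

theorem primrecRel_extends : PrimrecRel fun (x : List ℕ × List ℕ) (τ : List ℕ) =>
    Extends x.1 x.2.length (fun j => x.2.getD j 0) τ := by
  have hτ : Primrec fun z : ℕ × (List ℕ × List ℕ) × List ℕ => z.2.2 := Primrec.snd.comp .snd
  have hσ : Primrec fun z : ℕ × (List ℕ × List ℕ) × List ℕ => z.2.1.1 :=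
    Primrec.fst.comp (Primrec.fst.comp .snd)
  have hv : Primrec fun z : ℕ × (List ℕ × List ℕ) × List ℕ => z.2.1.2 :=
    Primrec.snd.comp (Primrec.fst.comp .snd)
  have ht : Primrec fun z : ℕ × (List ℕ × List ℕ) × List ℕ => z.1.unpair.2 :=
    Primrec.snd.comp (Primrec.unpair.comp .fst)
  have hR₁ : PrimrecPred fun z : ℕ × (List ℕ × List ℕ) × List ℕ => z.2.1.1.length ≤ z.1 :=
    Primrec.nat_le.comp (Primrec.list_length.comp hσ) .fst
  have hR₂ : PrimrecPred fun z : ℕ × (List ℕ × List ℕ) × List ℕ =>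
      z.1.unpair.2 < z.2.1.2.length :=
    Primrec.nat_lt.comp ht (Primrec.list_length.comp hv)
  have hR₃ : PrimrecPred fun z : ℕ × (List ℕ × List ℕ) × List ℕ =>
      z.2.2[z.1]? = some (z.2.1.2.getD z.1.unpair.2 0) :=
    Primrec.eq.comp (Primrec.list_getElem?.comp hτ .fst)
      (Primrec.option_some.comp ((Primrec.list_getD 0).comp hv ht))
  have hR : PrimrecRel fun (t : ℕ) (z : (List ℕ × List ℕ) × List ℕ) =>
      ¬ z.1.1.length ≤ t ∨ ¬ t.unpair.2 < z.1.2.length ∨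
        z.2[t]? = some (z.1.2.getD t.unpair.2 0) :=
    hR₁.not.or (hR₂.not.or hR₃)
  have hpre : PrimrecPred fun z : (List ℕ × List ℕ) × List ℕ =>
      z.1.1 = z.2.take z.1.1.length :=
    Primrec.eq.comp (Primrec.fst.comp .fst)
      (Primrec.list_take.comp (Primrec.list_length.comp (Primrec.fst.comp .fst)) .snd)
  have hall : PrimrecPred fun z : (List ℕ × List ℕ) × List ℕ => ∀ t < z.2.length,
      ¬ z.1.1.length ≤ t ∨ ¬ t.unpair.2 < z.1.2.length ∨
        z.2[t]? = some (z.1.2.getD t.unpair.2 0) :=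
    forall_lt_primrec hR (Primrec.list_length.comp .snd)
  have h : PrimrecPred fun z : (List ℕ × List ℕ) × List ℕ =>
      Extends z.1.1 z.1.2.length (fun j => z.1.2.getD j 0) z.2 := by
    refine (hpre.and hall).of_eq fun z => ?_
    refine and_congr List.prefix_iff_eq_take.symm (forall₂_congr fun t _ => ?_)
    rw [imp_iff_not_or, imp_iff_not_or]
  exact h

theorem exists_index_extends : ∃ f : ℕ × List ℕ × List ℕ → ℕ, Primrec f ∧
    ∀ i σ m p q, haltsOn (f (i, σ, pre p m)) q ↔ ∃ τ, Extends σ m p τ ∧ HaltsWithin i τ := by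
  have hd : Primrec fun z : (ℕ × List ℕ × List ℕ) × ℕ => ofNat (List ℕ × ℕ × ℕ) z.2 :=
    (Primrec.ofNat _).comp .snd
  obtain ⟨f, hf, h⟩ := exists_index_const (R := fun (x : ℕ × List ℕ × List ℕ) (m : ℕ) =>
    Extends x.2.1 x.2.2.length (fun j => x.2.2.getD j 0) (ofNat (List ℕ × ℕ × ℕ) m).1 ∧
    (Code.evaln (ofNat (List ℕ × ℕ × ℕ) m).2.2 (ofNat Code x.1)
      (encode ((ofNat (List ℕ × ℕ × ℕ) m).1.take (ofNat (List ℕ × ℕ × ℕ) m).2.1))).isSome = true)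
    ((primrecRel_extends.comp (Primrec.snd.comp .fst) (Primrec.fst.comp hd)).and
      (primrecRel_evaln_isSome (Primrec.snd.comp (Primrec.snd.comp hd)) (Primrec.fst.comp .fst)
        (Primrec.list_take.comp (Primrec.fst.comp (Primrec.snd.comp hd)) (Primrec.fst.comp hd))))
  refine ⟨f, hf, fun i σ m p q => ?_⟩
  have hp : ∀ τ, Extends σ (pre p m).length (fun j => (pre p m).getD j 0) τ ↔
      Extends σ m p τ := fun τ => by
    rw [length_pre]
    exact extends_congr fun j hj => by rw [List.getD_eq_getElem?_getD, getElem?_pre hj]; rfl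
  simp only [h, hp, haltsWithin_iff_evaln]
  constructor
  · rintro ⟨m, hm, h⟩
    exact ⟨_, hm, _, _, h⟩
  · rintro ⟨τ, hτ, k, s, h⟩
    exact ⟨encode (τ, k, s), by simpa only [ofNat_encode] using ⟨hτ, h⟩⟩

theorem exists_generic_step (p : Baire) (i : ℕ) (σ : List ℕ) : ∃ τ,
    Extends σ σ.length p τ ∧ σ.length < τ.length ∧
      (HaltsWithin i τ ∨ ¬∃ ρ, Extends σ σ.length p ρ ∧ HaltsWithin i ρ) := by
  have key : ∀ ρ, Extends σ σ.length p ρ →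
      Extends σ σ.length p (ρ ++ [p ρ.length.unpair.2]) := by
    refine fun ρ hρ => hρ.trans ⟨List.prefix_append _ _, fun t ht ht' _ => ?_⟩ le_rfl
    obtain rfl : t = ρ.length := by simp at ht; omega
    simp
  by_cases h : ∃ ρ, Extends σ σ.length p ρ ∧ HaltsWithin i ρ
  · obtain ⟨ρ, hρ, hi⟩ := h
    refine ⟨_, key ρ hρ, ?_, .inl (hi.mono (List.prefix_append _ _))⟩
    have := hρ.1.length_le
    simp
    omega
  · exact ⟨_, key σ (.refl _ _ _), by simp, .inr h⟩

/-- There is a sequence converging to `p` whose jump is decided by finite conditions. -/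
theorem exists_generic (p : Baire) : ∃ (r : Baire) (σ : ℕ → List ℕ),
    (∀ s, s ≤ (σ s).length) ∧ (∀ s, σ s = pre r (σ s).length) ∧
    (∀ s t, (σ s).length ≤ t → t.unpair.2 < (σ s).length → r t = p t.unpair.2) ∧
    ∀ s, ∀ i < s, HaltsWithin i (σ s) ∨
      ¬∃ ρ, Extends (σ s) (σ s).length p ρ ∧ HaltsWithin i ρ := by
  choose f hf hlt hhalt using exists_generic_step p
  let σ : ℕ → List ℕ := Nat.rec [] f
  have hσ : ∀ s, σ (s + 1) = f s (σ s) := fun _ => rfl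
  have hlen : ∀ s, s ≤ (σ s).length := by
    intro s
    induction s with
    | zero => exact Nat.zero_le _
    | succ s ih =>
      have := hlt s (σ s)
      rw [hσ]
      omega
  have hext : ∀ s s', s ≤ s' → Extends (σ s) (σ s).length p (σ s') := by
    intro s s' h
    induction h with
    | refl => exact .refl _ _ _
    | step _ ih => exact ih.trans (hf _ _) ih.1.length_le
  have hget : ∀ s t, t < (σ s).length → (σ s)[t]? = some ((σ (t + 1)).getD t 0) := by
    intro s t ht
    have ht' : t < (σ (t + 1)).length := hlen (t + 1)
    rw [List.getD_eq_getElem?_getD, List.getElem?_eq_getElem ht', Option.getD_some,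
      ← List.getElem?_eq_getElem ht']
    rcases le_total s (t + 1) with h | h
    · obtain ⟨x, hx⟩ := (hext _ _ h).1
      rw [← hx, List.getElem?_append_left ht]
    · obtain ⟨x, hx⟩ := (hext _ _ h).1
      rw [← hx, List.getElem?_append_left ht']
  refine ⟨fun t => (σ (t + 1)).getD t 0, σ, hlen, fun s => eq_pre (hget s), ?_, ?_⟩
  · intro s t hst ht
    have hs : s ≤ t + 1 := (hlen s).trans (by omega)
    have h := (hext s (t + 1) hs).2 t (hlen (t + 1)) hst ht
    exact Option.some.inj ((hget (t + 1) t (hlen (t + 1))).symm.trans h)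
  · intro s i hi
    rcases hhalt i (σ i) with h | h
    · exact .inl (h.mono (hext (i + 1) s hi).1)
    · refine .inr fun ⟨ρ, hρ, hρi⟩ => h ⟨ρ, ?_, hρi⟩
      have := hext i s hi.le
      exact this.trans hρ this.1.length_le

theorem limB_eq_some_of_columns {r p : Baire}
    (h : ∀ n, ∃ N, ∀ t, N ≤ t → t.unpair.2 = n → r t = p n) : limB r = Part.some p := by
  rw [limB_eq_some_iff]
  intro n
  obtain ⟨N, hN⟩ := h n
  exact ⟨N, fun i hi => hN _ (hi.trans (Nat.left_le_pair i n)) (by simp)⟩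

theorem computableRel_of_exists {F : Baire →. Baire}
    (h : ∃ G : Baire →. Baire, ComputableFn G ∧
      ∀ p, (F p).Dom → ∀ r : Baire, limB r = Part.some p → G (jump r) = F p) :
    ComputableRel zero' F := by
  obtain ⟨G, ⟨η, hc, hm, hG⟩, hF⟩ := h
  obtain ⟨f, hf, hf'⟩ := exists_index_haltsWithin
  obtain ⟨g, hg, hg'⟩ := exists_index_extends
  let C : List ℕ → (List ℕ × List ℕ) × List ℕ → Prop := fun u d =>
    (∀ j < d.1.2.length, u[2 * j + 1]? = d.1.2[j]?) ∧
    ∀ i < d.2.length, (d.2[i]? = some 1 ∧ u[2 * f (i, d.1.1)]? = some 1) ∨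
      (d.2[i]? = some 0 ∧ u[2 * g (i, d.1)]? = some 0)
  have hC : PrimrecRel C := by
    have hu : Primrec fun z : ℕ × List ℕ × (List ℕ × List ℕ) × List ℕ => z.2.1 :=
      Primrec.fst.comp .snd
    have hd : Primrec fun z : ℕ × List ℕ × (List ℕ × List ℕ) × List ℕ => z.2.2.1 :=
      Primrec.fst.comp (Primrec.snd.comp .snd)
    have hw : Primrec fun z : ℕ × List ℕ × (List ℕ × List ℕ) × List ℕ => z.2.2.2 :=
      Primrec.snd.comp (Primrec.snd.comp .snd)
    have hR₁ : PrimrecRel fun (j : ℕ) (x : List ℕ × (List ℕ × List ℕ) × List ℕ) =>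
        x.1[2 * j + 1]? = x.2.1.2[j]? :=
      Primrec.eq.comp (Primrec.list_getElem?.comp hu
        (Primrec.succ.comp (Primrec.nat_mul.comp (.const 2) .fst)))
        (Primrec.list_getElem?.comp (Primrec.snd.comp hd) .fst)
    have hR₂ : PrimrecRel fun (i : ℕ) (x : List ℕ × (List ℕ × List ℕ) × List ℕ) =>
        x.2.2[i]? = some 1 ∧ x.1[2 * f (i, x.2.1.1)]? = some 1 :=
      PrimrecPred.and (Primrec.eq.comp (Primrec.list_getElem?.comp hw .fst) (.const (some 1)))
        (Primrec.eq.comp (Primrec.list_getElem?.comp hu (Primrec.nat_mul.comp (.const 2)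
          (hf.comp (Primrec.pair .fst (Primrec.fst.comp hd))))) (.const (some 1)))
    have hR₃ : PrimrecRel fun (i : ℕ) (x : List ℕ × (List ℕ × List ℕ) × List ℕ) =>
        x.2.2[i]? = some 0 ∧ x.1[2 * g (i, x.2.1)]? = some 0 :=
      PrimrecPred.and (Primrec.eq.comp (Primrec.list_getElem?.comp hw .fst) (.const (some 0)))
        (Primrec.eq.comp (Primrec.list_getElem?.comp hu (Primrec.nat_mul.comp (.const 2)
          (hg.comp (Primrec.pair .fst hd)))) (.const (some 0)))
    exact PrimrecPred.and
      (forall_lt_primrec hR₁ (Primrec.list_length.comp (Primrec.snd.comp (Primrec.fst.comp .snd))))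
      (forall_lt_primrec (PrimrecPred.or hR₂ hR₃)
        (Primrec.list_length.comp (Primrec.snd.comp .snd)))
  obtain ⟨η', hc', hm', hη⟩ := exists_approx_of_certificate hc hm hC
  refine ⟨ofApprox η', computableFn_ofApprox hc' hm', fun p q hq => ?_⟩
  have hx : ∀ r, limB r = Part.some p → ∀ n, ∃ j, η (pre (jump r) j) n = some (q n) :=
    fun r hr => hG _ _ (by rw [hF p (Part.dom_iff_mem.2 ⟨q, hq⟩) r hr]; exact hq)
  rw [mem_ofApprox hm']
  refine hη _ q ?_ ?_
  · rintro k ⟨σ, v⟩ w ⟨hv, hw⟩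
    have hv' : v = pre p v.length := eq_pre fun j hj => by
      rw [← hv j hj, getElem?_pre, pairB_odd]
      exact lt_of_getElem?_pre ((hv j hj).trans (List.getElem?_eq_getElem hj))
    let r : Baire := fun t => σ[t]?.getD (p t.unpair.2)
    have hσr : σ = pre r σ.length := eq_pre fun t ht => by
      simp only [r, List.getElem?_eq_getElem ht, Option.getD_some]
    have hr : ∀ t, σ.length ≤ t → r t = p t.unpair.2 := fun t ht => by
      simp only [r, List.getElem?_eq_none ht, Option.getD_none]
    refine ⟨jump r, eq_pre fun i hi => ?_, hx r (limB_eq_some_of_columns fun n =>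
      ⟨σ.length, fun t ht htn => htn ▸ hr t ht⟩)⟩
    rcases hw i hi with ⟨hwi, h⟩ | ⟨hwi, h⟩
    · have h := eq_of_getElem?_pre h
      rw [pairB_even, zero', jump_eq_one, hf'] at h
      rw [hwi, eq_comm, Option.some_inj, jump_eq_one, haltsOn_iff_haltsWithin]
      exact ⟨_, hσr ▸ h⟩
    · have h := eq_of_getElem?_pre h
      rw [hv', pairB_even, zero', jump_eq_zero, hg'] at h
      rw [hwi, eq_comm, Option.some_inj, jump_eq_zero, haltsOn_iff_haltsWithin]
      rintro ⟨k, hk⟩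
      exact h ⟨_, extends_pre hσr (fun t ht _ => hr t ht) (le_max_right k _),
        hk.mono (pre_mono r (le_max_left _ _))⟩
  · obtain ⟨r, σ, hlen, hσr, hr, hhalt⟩ := exists_generic p
    refine ⟨jump r, hx r (limB_eq_some_of_columns fun n => ⟨(σ (n + 1)).length, fun t ht htn => ?_⟩),
      fun j => ⟨(σ j, pre p (σ j).length), ?_⟩⟩
    · subst htn
      exact hr _ t ht (hlen _)
    · refine ((eventually_forall_lt fun i hi => ?_).and (eventually_forall_lt fun i hi => ?_)).exists
      · rw [length_pre] at hi
        simpa only [getElem?_pre hi, pairB_odd] using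
          eventually_getElem?_pre (pairB zero' p) (2 * i + 1)
      · rw [length_pre] at hi
        simp only [getElem?_pre hi, Option.some_inj, jump_eq_one, jump_eq_zero]
        rcases hhalt j i hi with h | h
        · filter_upwards [eventually_getElem?_pre (pairB zero' p) (2 * f (i, σ j))] with k hk
          refine .inl ⟨haltsOn_iff_haltsWithin.2 ⟨_, hσr j ▸ h⟩, hk.trans ?_⟩
          rw [pairB_even, Option.some_inj, zero', jump_eq_one, hf']
          exact h
        · filter_upwards [eventually_getElem?_pre (pairB zero' p)
            (2 * g (i, σ j, pre p (σ j).length))] with k hk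
          refine .inr ⟨fun hi' => h ?_, hk.trans ?_⟩
          · obtain ⟨l, hl⟩ := haltsOn_iff_haltsWithin.1 hi'
            exact ⟨_, extends_pre (hσr j) (hr j) (le_max_right l _),
              hl.mono (pre_mono r (le_max_left _ _))⟩
          · rw [pairB_even, Option.some_inj, zero', jump_eq_zero, hg']
            exact h

end LimitComp

namespace LimitComp

/-- **Computability relative to the halting problem.** A partial function
`F :⊆ ℕ^ℕ → ℕ^ℕ` is computable relative to the halting problem `0'` if and only
if there is a computable partial function `G :⊆ ℕ^ℕ → ℕ^ℕ` with `F = G ∘ H`,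
where `H := J ∘ lim⁻¹` is the multi-valued map assigning to `p` the Turing jumps
of all sequences converging to `p` (so `F = G ∘ H` means `G(J(r)) = F(p)` for
every `p ∈ dom F` and every `r` with `lim r = p`). -/
theorem halting_problem_characterization (F : Baire →. Baire) :
    ComputableRel zero' F ↔
      ∃ G : Baire →. Baire, ComputableFn G ∧
        ∀ p, (F p).Dom → ∀ r : Baire, limB r = Part.some p → G (jump r) = F p := by
  exact ⟨exists_of_computableRel, computableRel_of_exists⟩

end LimitComp
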